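/- Let T be an infinite, locally finite, spherically symmetric rooted tree with constant interaction strength J_v ≡ J > 0, inverse temperature β > 0 and θ = tanh(β J) ∈ (0,1). Let |T_n| denote the number of vertices at distance n from the root, and suppose there are constants 0 < c ≤ C and α ∈ ℝ with c θ^{-n} n^α ≤ |T_n| ≤ C θ^{-n} n^α for all n ≥ 1. Then lim_N P^(N,+)(η(o) = +1) = 1/2 (i.e., there is a unique Gibbs state for the Ising model at this critical temperature) if and only if α ≤ 1/2. -/

import Mathlib

open scoped ENNReal Classical

noncomputable section

/-- Vertices of the canonical rooted tree: finite sequences of naturals; the root is `[]`. -/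
abbrev Vtx := List ℕ

/-- Vertices of the tree determined by the child-count function `c`. -/
inductive IsVtx (c : Vtx → ℕ) : Vtx → Prop
  | root : IsVtx c []
  | child {v : Vtx} {i : ℕ} : IsVtx c v → i < c v → IsVtx c (v ++ [i])

/-- A flow: conservation at every non-root, non-leaf vertex (edges are identified with their
lower endpoints). -/
def IsFlow (c : Vtx → ℕ) (μ : Vtx → ℝ≥0∞) : Prop :=
  ∀ v : Vtx, IsVtx c v → v ≠ [] → c v ≠ 0 →
    μ v = ∑ i ∈ Finset.range (c v), μ (v ++ [i])

/-- Total flow out of the root. -/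
def flowMass (c : Vtx → ℕ) (μ : Vtx → ℝ≥0∞) : ℝ≥0∞ :=
  ∑ i ∈ Finset.range (c []), μ [i]

/-- An infinite ray from the root. -/
def IsRay (c : Vtx → ℕ) (y : ℕ → ℕ) : Prop :=
  ∀ n : ℕ, y n < c ((List.range n).map y)

/-- `V_μ(y) = Σ_{e ∈ y} (μ(e) R(e))^s` along an infinite ray. -/
def rayPot (μ R : Vtx → ℝ≥0∞) (s : ℝ) (y : ℕ → ℕ) : ℝ≥0∞ :=
  ∑' n : ℕ, (μ ((List.range (n + 1)).map y) * R ((List.range (n + 1)).map y)) ^ s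

/-- `V_μ` along the maximal path from the root to a leaf `ℓ`. -/
def leafPot (μ R : Vtx → ℝ≥0∞) (s : ℝ) (ℓ : Vtx) : ℝ≥0∞ :=
  ∑ k ∈ Finset.range ℓ.length, (μ (ℓ.take (k + 1)) * R (ℓ.take (k + 1))) ^ s

/-- `cap_p` of an infinite leafless tree. -/
def capInf (c : Vtx → ℕ) (R : Vtx → ℝ≥0∞) (p : ℝ) : ℝ≥0∞ :=
  sSup {m | ∃ μ : Vtx → ℝ≥0∞, IsFlow c μ ∧
    (∀ y : ℕ → ℕ, IsRay c y → rayPot μ R (p - 1) y ≤ 1) ∧ m = flowMass c μ}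

/-- `cap_p` of a finite tree. -/
def capFin (c : Vtx → ℕ) (R : Vtx → ℝ≥0∞) (p : ℝ) : ℝ≥0∞ :=
  sSup {m | ∃ μ : Vtx → ℝ≥0∞, IsFlow c μ ∧
    (∀ ℓ : Vtx, IsVtx c ℓ → c ℓ = 0 → leafPot μ R (p - 1) ℓ ≤ 1) ∧ m = flowMass c μ}

/-- The set of vertices at distance `n` from the root. -/
def lev (c : Vtx → ℕ) : ℕ → Finset Vtx
  | 0 => {([] : Vtx)}
  | n + 1 => (lev c n).biUnion fun v => (Finset.range (c v)).image fun i => v ++ [i]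

/-- The vertices of the truncated tree `T^(N)`. -/
def verts (c : Vtx → ℕ) (N : ℕ) : Finset Vtx := (Finset.range (N + 1)).biUnion (lev c)

/-- Spin configurations on `T^(N)`. -/
def Conf (c : Vtx → ℕ) (N : ℕ) := {v // v ∈ verts c N} → Bool

instance (c : Vtx → ℕ) (N : ℕ) : Fintype (Conf c N) := by unfold Conf; infer_instance

/-- The ±1 spin of a configuration at a vertex. -/
def spin (c : Vtx → ℕ) (N : ℕ) (σ : Conf c N) (w : Vtx) : ℝ :=
  if h : w ∈ verts c N then (if σ ⟨w, h⟩ then 1 else -1) else 1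

/-- The weight `W(η) = Π_{v → w} exp(β J_w η(v) η(w))` of a configuration on `T^(N)`. -/
def wt (c : Vtx → ℕ) (J : Vtx → ℝ) (β : ℝ) (N : ℕ) (σ : Conf c N) : ℝ :=
  ∏ w ∈ (Finset.range N).biUnion (fun n => lev c (n + 1)),
    Real.exp (β * J w * spin c N σ w.dropLast * spin c N σ w)

/-- `P^(N,+)(η(o) = +1)`: probability of a plus spin at the root under plus boundary
conditions at level `N`. -/
def plusProb (c : Vtx → ℕ) (J : Vtx → ℝ) (β : ℝ) (N : ℕ) : ℝ :=
  (∑ σ : Conf c N, if (∀ x : {v // v ∈ verts c N}, x.1 ∈ lev c N → σ x = true)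
      ∧ spin c N σ [] = 1 then wt c J β N σ else 0) /
  (∑ σ : Conf c N, if (∀ x : {v // v ∈ verts c N}, x.1 ∈ lev c N → σ x = true)
      then wt c J β N σ else 0)

section Combinatorics

variable {c : Vtx → ℕ}

lemma isVtx_and_length_of_mem_lev {n : ℕ} {v : Vtx} (hv : v ∈ lev c n) :
    IsVtx c v ∧ v.length = n := by
  induction n generalizing v with
  | zero =>
    simp only [lev, Finset.mem_singleton] at hv
    subst hv
    exact ⟨IsVtx.root, rfl⟩
  | succ n ih =>
    simp only [lev, Finset.mem_biUnion, Finset.mem_image, Finset.mem_range] at hv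
    obtain ⟨u, hu, i, hi, rfl⟩ := hv
    obtain ⟨h1, h2⟩ := ih hu
    exact ⟨IsVtx.child h1 hi, by simp [h2]⟩

lemma disjoint_verts_lev (c : Vtx → ℕ) (N : ℕ) : Disjoint (verts c N) (lev c (N + 1)) := by
  rw [Finset.disjoint_left]
  intro v hv hv'
  simp only [verts, Finset.mem_biUnion, Finset.mem_range] at hv
  obtain ⟨n, hn, hv⟩ := hv
  have := (isVtx_and_length_of_mem_lev hv).2
  have := (isVtx_and_length_of_mem_lev hv').2
  omega

lemma mem_verts_of_mem_lev {n N : ℕ} {v : Vtx} (h : n ≤ N) (hv : v ∈ lev c n) :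
    v ∈ verts c N :=
  Finset.mem_biUnion.2 ⟨n, Finset.mem_range.2 (by omega), hv⟩

lemma verts_succ (c : Vtx → ℕ) (N : ℕ) : verts c (N + 1) = verts c N ∪ lev c (N + 1) := by
  rw [verts, Finset.range_add_one, Finset.biUnion_insert, Finset.union_comm, verts]

lemma pairwiseDisjoint_children (c : Vtx → ℕ) (s : Set Vtx) :
    s.PairwiseDisjoint fun v => (Finset.range (c v)).image fun i => v ++ [i] := by
  intro v _ w _ hvw
  rw [Function.onFun, Finset.disjoint_left]
  intro x hx hx'
  simp only [Finset.mem_image] at hx hx'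
  obtain ⟨i, -, rfl⟩ := hx
  obtain ⟨j, -, h⟩ := hx'
  exact hvw (List.append_inj_left' h rfl).symm

lemma prod_lev_succ (c : Vtx → ℕ) (N : ℕ) (f : Vtx → ℝ) :
    ∏ w ∈ lev c (N + 1), f w = ∏ v ∈ lev c N, ∏ i ∈ Finset.range (c v), f (v ++ [i]) := by
  rw [lev, Finset.prod_biUnion (pairwiseDisjoint_children c _)]
  refine Finset.prod_congr rfl fun v _ => Finset.prod_image fun i _ j _ h => ?_
  simpa using h

lemma card_lev_succ {N k : ℕ} (h : ∀ v ∈ lev c N, c v = k) :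
    (lev c (N + 1)).card = (lev c N).card * k := by
  rw [lev, Finset.card_biUnion (pairwiseDisjoint_children c _)]
  refine Finset.sum_const_nat fun v hv => ?_
  rw [Finset.card_image_of_injective _ fun i j h => by simpa using h, Finset.card_range, h v hv]

/-- The `±1` value of a Boolean spin. -/
def sgn (t : Bool) : ℝ := if t then 1 else -1

lemma spin_of_mem {N : ℕ} (σ : Conf c N) {w : Vtx} (h : w ∈ verts c N) :
    spin c N σ w = sgn (σ ⟨w, h⟩) := by
  simp [spin, sgn, h]

lemma sgn_eq_one_iff (t : Bool) : sgn t = 1 ↔ t = true := by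
  cases t <;> norm_num [sgn]

lemma spin_eq (N : ℕ) (σ : Conf c N) (w : Vtx) : spin c N σ w = 1 ∨ spin c N σ w = -1 := by
  unfold spin
  split_ifs <;> simp

/-- A configuration on `T^(N+1)` is one on `T^(N)` together with spins on level `N + 1`. -/
def confSucc (c : Vtx → ℕ) (N : ℕ) :
    Conf c N × ({w // w ∈ lev c (N + 1)} → Bool) ≃ Conf c (N + 1) where
  toFun p := fun x => if h : x.1 ∈ verts c N then p.1 ⟨x.1, h⟩ else
    p.2 ⟨x.1, by
      have hx : x.1 ∈ verts c N ∪ lev c (N + 1) := by rw [← verts_succ]; exact x.2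
      exact (Finset.mem_union.1 hx).resolve_left h⟩
  invFun σ := (fun x => σ ⟨x.1, by rw [verts_succ]; exact Finset.mem_union_left _ x.2⟩,
    fun x => σ ⟨x.1, mem_verts_of_mem_lev le_rfl x.2⟩)
  left_inv p := by
    refine Prod.ext (funext fun x => ?_) (funext fun x => ?_)
    · simp [x.2]
    · have : x.1 ∉ verts c N := fun h => Finset.disjoint_left.1 (disjoint_verts_lev c N) h x.2
      simp [this]
  right_inv σ := by
    funext x
    by_cases h : x.1 ∈ verts c N <;> simp [h]

lemma spin_confSucc_of_mem_verts {N : ℕ} (σ : Conf c N) (τ : {w // w ∈ lev c (N + 1)} → Bool)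
    {v : Vtx} (hv : v ∈ verts c N) :
    spin c (N + 1) (confSucc c N (σ, τ)) v = spin c N σ v := by
  rw [spin_of_mem σ hv,
    spin_of_mem _ (by rw [verts_succ]; exact Finset.mem_union_left _ hv)]
  exact congrArg sgn (dif_pos hv)

lemma spin_confSucc_of_mem_lev {N : ℕ} (σ : Conf c N) (τ : {w // w ∈ lev c (N + 1)} → Bool)
    {w : Vtx} (hw : w ∈ lev c (N + 1)) :
    spin c (N + 1) (confSucc c N (σ, τ)) w = sgn (τ ⟨w, hw⟩) := by
  have : w ∉ verts c N := fun h => Finset.disjoint_left.1 (disjoint_verts_lev c N) h hw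
  rw [spin_of_mem _ (mem_verts_of_mem_lev le_rfl hw)]
  exact congrArg sgn (dif_neg this)

lemma dropLast_mem_lev {N : ℕ} {w : Vtx} (hw : w ∈ lev c (N + 1)) : w.dropLast ∈ lev c N := by
  simp only [lev, Finset.mem_biUnion, Finset.mem_image] at hw
  obtain ⟨v, hv, i, -, rfl⟩ := hw
  simpa using hv

lemma wt_confSucc (J : Vtx → ℝ) (β : ℝ) (N : ℕ) (σ : Conf c N)
    (τ : {w // w ∈ lev c (N + 1)} → Bool) :
    wt c J β (N + 1) (confSucc c N (σ, τ)) = wt c J β N σ *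
      ∏ w : {w // w ∈ lev c (N + 1)},
        Real.exp (β * J w * spin c N σ w.1.dropLast * sgn (τ w)) := by
  have hsub : ∀ n, n < N → ∀ w ∈ lev c (n + 1), w ∈ verts c N := fun n hn w hw =>
    mem_verts_of_mem_lev (by omega) hw
  have hdisj : Disjoint (lev c (N + 1)) ((Finset.range N).biUnion fun n => lev c (n + 1)) := by
    refine (Finset.disjoint_of_subset_left ?_ (disjoint_verts_lev c N)).symm
    intro w hw
    simp only [Finset.mem_biUnion, Finset.mem_range] at hw
    obtain ⟨n, hn, hw⟩ := hw
    exact hsub n hn w hw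
  rw [wt, Finset.range_add_one, Finset.biUnion_insert, Finset.prod_union hdisj, mul_comm, wt]
  congr 1
  · refine Finset.prod_congr rfl fun w hw => ?_
    simp only [Finset.mem_biUnion, Finset.mem_range] at hw
    obtain ⟨n, hn, hw⟩ := hw
    rw [spin_confSucc_of_mem_verts _ _ (hsub n hn w hw), spin_confSucc_of_mem_verts _ _
      (mem_verts_of_mem_lev hn.le (dropLast_mem_lev hw))]
  · rw [← Finset.prod_coe_sort]
    refine Finset.prod_congr rfl fun w _ => ?_
    rw [spin_confSucc_of_mem_lev _ _ w.2, spin_confSucc_of_mem_verts _ _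
      (mem_verts_of_mem_lev le_rfl (dropLast_mem_lev w.2))]

/-- The function on spins with value `p.1` at `+1` and `p.2` elsewhere. -/
def spinFun (p : ℝ × ℝ) (s : ℝ) : ℝ := if s = 1 then p.1 else p.2

/-- The effect on a vertex with `k` children of the weights `p` at the children. -/
def pullback (b : ℝ) (k : ℕ) (p : ℝ × ℝ) : ℝ × ℝ :=
  ((Real.exp b * p.1 + Real.exp (-b) * p.2) ^ k, (Real.exp (-b) * p.1 + Real.exp b * p.2) ^ k)

/-- Weights at the root resulting from the weights `p` at level `N`. -/
def rootWeight (b : ℝ) (d : ℕ → ℕ) : ℕ → ℝ × ℝ → ℝ × ℝ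
  | 0, p => p
  | N + 1, p => rootWeight b d N (pullback b (d N) p)

/-- Partition function with weight `r` at the root and weights `p` on level `N`. -/
def partitionSum (c : Vtx → ℕ) (J : Vtx → ℝ) (β : ℝ) (r p : ℝ × ℝ) (N : ℕ) : ℝ :=
  ∑ σ : Conf c N, spinFun r (spin c N σ []) * wt c J β N σ *
    ∏ v ∈ lev c N, spinFun p (spin c N σ v)

lemma sum_spin_pow (b : ℝ) (k : ℕ) (p : ℝ × ℝ) {s : ℝ} (hs : s = 1 ∨ s = -1) :
    (∑ t : Bool, Real.exp (b * s * sgn t) * spinFun p (sgn t)) ^ k =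
      spinFun (pullback b k p) s := by
  have h : ¬ ((-1 : ℝ) = 1) := by norm_num
  rcases hs with rfl | rfl <;> simp [sgn, spinFun, pullback, h]

lemma root_mem_verts (c : Vtx → ℕ) (N : ℕ) : ([] : Vtx) ∈ verts c N :=
  mem_verts_of_mem_lev (n := 0) (Nat.zero_le _) (by simp [lev])

lemma partitionSum_succ (J β : ℝ) (r p : ℝ × ℝ) {N k : ℕ} (hk : ∀ v ∈ lev c N, c v = k) :
    partitionSum c (fun _ => J) β r p (N + 1) =
      partitionSum c (fun _ => J) β r (pullback (β * J) k p) N := by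
  rw [partitionSum, ← (confSucc c N).sum_comp, Fintype.sum_prod_type, partitionSum]
  refine Finset.sum_congr rfl fun σ _ => ?_
  have h1 : ∀ τ : {w // w ∈ lev c (N + 1)} → Bool,
      spinFun r (spin c (N + 1) (confSucc c N (σ, τ)) []) *
        wt c (fun _ => J) β (N + 1) (confSucc c N (σ, τ)) *
        ∏ v ∈ lev c (N + 1), spinFun p (spin c (N + 1) (confSucc c N (σ, τ)) v) =
      spinFun r (spin c N σ []) * wt c (fun _ => J) β N σ *
        ∏ w : {w // w ∈ lev c (N + 1)},
          (Real.exp (β * J * spin c N σ w.1.dropLast * sgn (τ w)) * spinFun p (sgn (τ w))) := by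
    intro τ
    rw [spin_confSucc_of_mem_verts _ _ (root_mem_verts c N), wt_confSucc,
      ← Finset.prod_coe_sort (lev c (N + 1)), Finset.prod_mul_distrib]
    simp only [fun w : {w // w ∈ lev c (N + 1)} => spin_confSucc_of_mem_lev σ τ w.2]
    ring
  simp only [h1]
  rw [← Finset.mul_sum]
  congr 1
  have h2 := Finset.prod_univ_sum (fun _ : {w // w ∈ lev c (N + 1)} => (Finset.univ : Finset Bool))
    (fun w t => Real.exp (β * J * spin c N σ w.1.dropLast * sgn t) * spinFun p (sgn t))
  rw [Fintype.piFinset_univ] at h2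
  rw [← h2, Finset.prod_coe_sort (lev c (N + 1)) (fun w =>
    ∑ t : Bool, Real.exp (β * J * spin c N σ w.dropLast * sgn t) * spinFun p (sgn t)),
    prod_lev_succ]
  refine Finset.prod_congr rfl fun v hv => ?_
  simp only [List.dropLast_concat, Finset.prod_const, Finset.card_range, hk v hv]
  exact sum_spin_pow _ _ _ (spin_eq N σ v)

lemma partitionSum_zero (J : Vtx → ℝ) (β : ℝ) (r p : ℝ × ℝ) :
    partitionSum c J β r p 0 = r.1 * p.1 + r.2 * p.2 := by
  have hv : verts c 0 = {[]} := by simp [verts, lev]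
  have hr := root_mem_verts c 0
  let e : Bool ≃ Conf c 0 :=
    { toFun := fun t _ => t
      invFun := fun σ => σ ⟨[], hr⟩
      left_inv := fun t => rfl
      right_inv := fun σ => by
        funext ⟨x, hx⟩
        rw [hv, Finset.mem_singleton] at hx
        subst hx
        rfl }
  have hs : ∀ t, spin c 0 (e t) [] = sgn t := fun t => spin_of_mem _ hr
  have h : ¬ ((-1 : ℝ) = 1) := by norm_num
  rw [partitionSum, ← e.sum_comp]
  simp [hs, wt, lev, sgn, spinFun, h]

lemma partitionSum_eq (J β : ℝ) (r p : ℝ × ℝ) {d : ℕ → ℕ} (hd : ∀ n, ∀ v ∈ lev c n, c v = d n)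
    (N : ℕ) :
    partitionSum c (fun _ => J) β r p N =
      r.1 * (rootWeight (β * J) d N p).1 + r.2 * (rootWeight (β * J) d N p).2 := by
  induction N generalizing p with
  | zero => exact partitionSum_zero _ _ _ _
  | succ N ih => rw [partitionSum_succ J β r p (hd N), ih, rootWeight]

lemma prod_spinFun_of_plus {N : ℕ} {σ : Conf c N}
    (h : ∀ x : {v // v ∈ verts c N}, x.1 ∈ lev c N → σ x = true) :
    ∏ v ∈ lev c N, spinFun (1, 0) (spin c N σ v) = 1 := by
  refine Finset.prod_eq_one fun v hv => ?_
  have hv' := mem_verts_of_mem_lev le_rfl hv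
  rw [spin_of_mem σ hv', h ⟨v, hv'⟩ hv]
  simp [spinFun, sgn]

lemma prod_spinFun_of_not_plus {N : ℕ} {σ : Conf c N}
    (h : ¬ ∀ x : {v // v ∈ verts c N}, x.1 ∈ lev c N → σ x = true) :
    ∏ v ∈ lev c N, spinFun (1, 0) (spin c N σ v) = 0 := by
  simp only [not_forall] at h
  obtain ⟨x, hx, hσ⟩ := h
  refine Finset.prod_eq_zero hx ?_
  rw [spin_of_mem σ x.2]
  exact if_neg fun h1 => hσ ((sgn_eq_one_iff _).1 h1)

lemma plusProb_eq (J β : ℝ) {d : ℕ → ℕ} (hd : ∀ n, ∀ v ∈ lev c n, c v = d n) (N : ℕ) :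
    plusProb c (fun _ => J) β N = (rootWeight (β * J) d N (1, 0)).1 /
      ((rootWeight (β * J) d N (1, 0)).1 + (rootWeight (β * J) d N (1, 0)).2) := by
  have h1 := partitionSum_eq (c := c) J β (1, 0) (1, 0) hd N
  have h2 := partitionSum_eq (c := c) J β (1, 1) (1, 0) hd N
  rw [one_mul, zero_mul, add_zero] at h1
  rw [one_mul, one_mul] at h2
  rw [plusProb, ← h2, ← h1]
  refine congrArg₂ (· / ·) (Finset.sum_congr rfl fun σ _ => ?_) (Finset.sum_congr rfl fun σ _ => ?_)
  · by_cases h : ∀ x : {v // v ∈ verts c N}, x.1 ∈ lev c N → σ x = true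
    · rw [prod_spinFun_of_plus h]
      by_cases hs : spin c N σ [] = 1
      · rw [if_pos ⟨h, hs⟩, spinFun, if_pos hs, one_mul, mul_one]
      · rw [if_neg fun h' => hs h'.2, spinFun, if_neg hs, zero_mul, zero_mul]
    · rw [prod_spinFun_of_not_plus h, if_neg fun h' => h h'.1, mul_zero]
  · by_cases h : ∀ x : {v // v ∈ verts c N}, x.1 ∈ lev c N → σ x = true
    · rw [prod_spinFun_of_plus h, if_pos h, mul_one, spinFun, ite_self, one_mul]
    · rw [prod_spinFun_of_not_plus h, if_neg h, mul_zero]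

end Combinatorics

section Field

lemma nonneg_of_hasDerivAt {g g' : ℝ → ℝ} (h0 : g 0 = 0) (hg : ∀ x, HasDerivAt g (g' x) x)
    (hg' : ∀ x, 0 < x → 0 ≤ g' x) {x : ℝ} (hx : 0 ≤ x) : 0 ≤ g x := by
  have hmono : MonotoneOn g (Set.Ici 0) := by
    refine monotoneOn_of_hasDerivWithinAt_nonneg (convex_Ici 0)
      (fun x _ => (hg x).continuousAt.continuousWithinAt) (fun x _ => (hg x).hasDerivWithinAt) ?_
    intro x hx
    rw [interior_Ici] at hx
    exact hg' x hx
  simpa [h0] using hmono Set.self_mem_Ici hx hx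

/-- Half the log-likelihood ratio that a child with half log-likelihood ratio `x` transmits
to its parent. -/
def transmit (b x : ℝ) : ℝ := (Real.log (Real.cosh (b + x)) - Real.log (Real.cosh (b - x))) / 2

lemma cosh_add_mul_cosh_sub (b x : ℝ) :
    Real.cosh (b + x) * Real.cosh (b - x) = Real.cosh b ^ 2 + Real.sinh x ^ 2 := by
  rw [Real.cosh_add, Real.cosh_sub]
  linear_combination Real.cosh b ^ 2 * Real.cosh_sq x + Real.sinh x ^ 2 * Real.cosh_sq b

lemma hasDerivAt_transmit (b x : ℝ) :
    HasDerivAt (transmit b)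
      (Real.sinh b * Real.cosh b / (Real.cosh b ^ 2 + Real.sinh x ^ 2)) x := by
  have h1 : HasDerivAt (fun x => Real.cosh (b + x)) (Real.sinh (b + x)) x := by
    simpa using ((hasDerivAt_id x).const_add b).cosh
  have h2 : HasDerivAt (fun x => Real.cosh (b - x)) (-Real.sinh (b - x)) x := by
    simpa using ((hasDerivAt_id x).const_sub b).cosh
  have p1 := Real.cosh_pos (b + x)
  have p2 := Real.cosh_pos (b - x)
  refine (((h1.log p1.ne').sub (h2.log p2.ne')).div_const 2).congr_deriv ?_
  rw [← cosh_add_mul_cosh_sub]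
  field_simp
  rw [Real.sinh_add, Real.sinh_sub, Real.cosh_add, Real.cosh_sub]
  linear_combination (2 * Real.sinh b * Real.cosh b) * Real.cosh_sq x

lemma sq_add_pow_four_le_sinh_sq {x : ℝ} (hx : 0 ≤ x) :
    x ^ 2 + x ^ 4 / 4 ≤ Real.sinh x ^ 2 := by
  have h : x / 2 ≤ Real.sinh (x / 2) := Real.self_le_sinh_iff.2 (by positivity)
  have hs : (x / 2) ^ 2 ≤ Real.sinh (x / 2) ^ 2 := by gcongr
  have h2 : Real.sinh x = 2 * Real.sinh (x / 2) * Real.cosh (x / 2) := by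
    rw [← Real.sinh_two_mul]
    ring_nf
  rw [h2, mul_pow, Real.cosh_sq]
  nlinarith [sq_nonneg x]

lemma sinh_le_mul_cosh {x : ℝ} (hx : 0 ≤ x) : Real.sinh x ≤ x * Real.cosh x := by
  have := nonneg_of_hasDerivAt (g := fun x => x * Real.cosh x - Real.sinh x)
    (g' := fun x => x * Real.sinh x) (by simp) (fun x => by
      refine (((hasDerivAt_id x).mul (Real.hasDerivAt_cosh x)).sub
        (Real.hasDerivAt_sinh x)).congr_deriv ?_
      simp) (fun x hx => mul_nonneg hx.le (Real.sinh_nonneg_iff.2 hx.le)) hx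
  linarith

lemma tanh_pos_of_pos {x : ℝ} (hx : 0 < x) : 0 < Real.tanh x := by
  rw [Real.tanh_eq_sinh_div_cosh]
  exact div_pos (Real.sinh_pos_iff.2 hx) (Real.cosh_pos x)

lemma tanh_mul_tanh_le_transmit {b x : ℝ} (hb : 0 < b) (hx : 0 ≤ x) :
    Real.tanh b * Real.tanh x ≤ transmit b x := by
  have hsb := Real.sinh_pos_iff.2 hb
  have hcb := Real.cosh_pos b
  have := nonneg_of_hasDerivAt
    (g := fun x => transmit b x - Real.tanh b * (Real.sinh x / Real.cosh x))
    (g' := fun x => Real.sinh b * Real.cosh b / (Real.cosh b ^ 2 + Real.sinh x ^ 2) -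
      Real.tanh b * (1 / Real.cosh x ^ 2)) (by simp [transmit]) (fun x => by
      refine ((hasDerivAt_transmit b x).sub (((Real.hasDerivAt_sinh x).div
        (Real.hasDerivAt_cosh x) (Real.cosh_pos x).ne').const_mul (Real.tanh b))).congr_deriv ?_
      rw [show Real.cosh x * Real.cosh x - Real.sinh x * Real.sinh x = 1 by
        linarith [Real.cosh_sq x]]) (fun x _ => by
      have hcx := Real.cosh_pos x
      rw [sub_nonneg, Real.tanh_eq_sinh_div_cosh, div_mul_div_comm, mul_one,
        div_le_div_iff₀ (by positivity) (by positivity), Real.cosh_sq x]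
      have h1 : 1 ≤ Real.cosh b ^ 2 := one_le_pow₀ (Real.one_le_cosh b)
      nlinarith [mul_nonneg (mul_nonneg hsb.le (sub_nonneg.2 h1)) (sq_nonneg (Real.sinh x))]) hx
  rw [Real.tanh_eq_sinh_div_cosh x]
  linarith

lemma transmit_pos {b x : ℝ} (hb : 0 < b) (hx : 0 < x) : 0 < transmit b x :=
  (mul_pos (tanh_pos_of_pos hb) (tanh_pos_of_pos hx)).trans_le
    (tanh_mul_tanh_le_transmit hb hx.le)

lemma tanh_sq_mul_sq_le {b x : ℝ} (hb : 0 < b) (hx : 0 < x) :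
    Real.tanh b ^ 2 * x ^ 2 ≤ transmit b x ^ 2 * (1 + x ^ 2) := by
  have h1 := tanh_mul_tanh_le_transmit hb hx.le
  have hb' := tanh_pos_of_pos hb
  have hx' := tanh_pos_of_pos hx
  have h2 : (Real.tanh b * Real.tanh x) ^ 2 ≤ transmit b x ^ 2 := by gcongr
  have h3 : x ^ 2 ≤ Real.tanh x ^ 2 * (1 + x ^ 2) := by
    have h := Real.self_le_sinh_iff.2 hx.le
    have h' : x ^ 2 ≤ Real.sinh x ^ 2 := by gcongr
    have hc := Real.cosh_pos x
    rw [Real.tanh_eq_sinh_div_cosh, div_pow, div_mul_eq_mul_div, le_div_iff₀ (by positivity),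
      Real.cosh_sq]
    nlinarith
  calc Real.tanh b ^ 2 * x ^ 2 ≤ Real.tanh b ^ 2 * (Real.tanh x ^ 2 * (1 + x ^ 2)) := by gcongr
    _ = (Real.tanh b * Real.tanh x) ^ 2 * (1 + x ^ 2) := by ring
    _ ≤ _ := by gcongr

/-- The constant in the upper bound on `transmit`. -/
def damping (b : ℝ) : ℝ := 1 / (4 * Real.cosh b ^ 2)

lemma damping_pos (b : ℝ) : 0 < damping b := by
  have := Real.cosh_pos b
  unfold damping
  positivity

lemma transmit_le {b x : ℝ} (hb : 0 < b) (hx : 0 ≤ x) :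
    transmit b x ≤ Real.tanh b * (x / √(1 + damping b * x ^ 2)) := by
  have hC := damping_pos b
  have hθ := tanh_pos_of_pos hb
  have hcb := Real.cosh_pos b
  set C := damping b with hCdef
  have hpos : ∀ x, 0 < 1 + C * x ^ 2 := fun x => by positivity
  have := nonneg_of_hasDerivAt
    (g := fun x => Real.tanh b * (x / √(1 + C * x ^ 2)) - transmit b x)
    (g' := fun x => Real.tanh b * (1 / √(1 + C * x ^ 2) ^ 3) -
      Real.sinh b * Real.cosh b / (Real.cosh b ^ 2 + Real.sinh x ^ 2)) (by simp [transmit])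
    (fun x => by
      have hq : HasDerivAt (fun x => 1 + C * x ^ 2) (C * (2 * x)) x := by
        simpa using ((hasDerivAt_pow 2 x).const_mul C).const_add 1
      have hD : 0 < √(1 + C * x ^ 2) := Real.sqrt_pos.2 (hpos x)
      have hD2 : √(1 + C * x ^ 2) ^ 2 = 1 + C * x ^ 2 := Real.sq_sqrt (hpos x).le
      refine ((((hasDerivAt_id x).div (hq.sqrt (hpos x).ne') hD.ne').const_mul
        (Real.tanh b)).sub (hasDerivAt_transmit b x)).congr_deriv ?_
      simp only [id]
      congr 2
      generalize √(1 + C * x ^ 2) = D at hD hD2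
      field_simp
      linarith)
    (fun x hx => by
      have hD : 0 < √(1 + C * x ^ 2) := Real.sqrt_pos.2 (hpos x)
      have hD2 : √(1 + C * x ^ 2) ^ 2 = 1 + C * x ^ 2 := Real.sq_sqrt (hpos x).le
      have hS := sq_add_pow_four_le_sinh_sq hx.le
      have hcC : 4 * C * Real.cosh b ^ 2 = 1 := by
        rw [hCdef, damping]
        field_simp
      have hrw : Real.sinh b * Real.cosh b / (Real.cosh b ^ 2 + Real.sinh x ^ 2) =
          Real.tanh b * (1 / (1 + 4 * C * Real.sinh x ^ 2)) := by
        rw [Real.tanh_eq_sinh_div_cosh, div_mul_div_comm, mul_one,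
          div_eq_div_iff (by positivity) (by positivity)]
        linear_combination Real.sinh b * Real.sinh x ^ 2 * hcC
      have key : √(1 + C * x ^ 2) ^ 3 ≤ 1 + 4 * C * Real.sinh x ^ 2 := by
        refine le_of_sq_le_sq ?_ (by positivity)
        calc (√(1 + C * x ^ 2) ^ 3) ^ 2 = (1 + C * x ^ 2) ^ 3 := by
              rw [← pow_mul, mul_comm 3 2, pow_mul, hD2]
          _ ≤ (1 + 4 * C * (x ^ 2 + x ^ 4 / 4)) ^ 2 := by
            rw [← sub_nonneg]
            have hpoly : (1 + 4 * C * (x ^ 2 + x ^ 4 / 4)) ^ 2 - (1 + C * x ^ 2) ^ 3 =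
                5 * C * x ^ 2 + (13 * C ^ 2 + 2 * C) * x ^ 4 +
                  (8 * C ^ 2 - C ^ 3) * x ^ 6 + C ^ 2 * x ^ 8 := by ring
            have hC1 : C ≤ 1 := by nlinarith [one_le_pow₀ (n := 2) (Real.one_le_cosh b)]
            have : 0 ≤ 8 * C ^ 2 - C ^ 3 := by nlinarith [sq_nonneg C]
            rw [hpoly]
            positivity
          _ ≤ _ := by gcongr
      rw [hrw, sub_nonneg]
      gcongr) hx
  linarith

lemma transmit_sq_mul_le {b x : ℝ} (hb : 0 < b) (hx : 0 < x) :
    transmit b x ^ 2 * (1 + damping b * x ^ 2) ≤ Real.tanh b ^ 2 * x ^ 2 := by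
  have hC := damping_pos b
  have h0 := transmit_pos hb hx
  have hpos : 0 < 1 + damping b * x ^ 2 := by positivity
  have h : transmit b x ^ 2 ≤ (Real.tanh b * (x / √(1 + damping b * x ^ 2))) ^ 2 := by
    gcongr
    exact transmit_le hb hx.le
  rwa [mul_pow, div_pow, Real.sq_sqrt hpos.le, ← mul_div_assoc, le_div_iff₀ hpos] at h

lemma inv_transmit_sq_bounds {b x : ℝ} (hb : 0 < b) (hx : 0 < x) :
    (Real.tanh b ^ 2)⁻¹ * ((x ^ 2)⁻¹ + damping b) ≤ (transmit b x ^ 2)⁻¹ ∧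
      (transmit b x ^ 2)⁻¹ ≤ (Real.tanh b ^ 2)⁻¹ * ((x ^ 2)⁻¹ + 1) := by
  have hθ := tanh_pos_of_pos hb
  have h0 := transmit_pos hb hx
  have e : ∀ C : ℝ, (Real.tanh b ^ 2)⁻¹ * ((x ^ 2)⁻¹ + C) =
      (1 + C * x ^ 2) / (Real.tanh b ^ 2 * x ^ 2) := fun C => by field_simp
  rw [e, e, inv_eq_one_div, div_le_div_iff₀ (by positivity) (by positivity),
    div_le_div_iff₀ (by positivity) (by positivity)]
  constructor
  · linarith [transmit_sq_mul_le hb hx]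
  · linarith [tanh_sq_mul_sq_le hb hx]

lemma inv_sq_bounds {b : ℝ} (hb : 0 < b) :
    (Real.tanh b ^ 2)⁻¹ * damping b ≤ (b ^ 2)⁻¹ ∧ (b ^ 2)⁻¹ ≤ (Real.tanh b ^ 2)⁻¹ := by
  have hθ := tanh_pos_of_pos hb
  have hc := Real.cosh_pos b
  have hs := Real.self_le_sinh_iff.2 hb.le
  have hs' := Real.sinh_pos_iff.2 hb
  constructor
  · have h : b ^ 2 ≤ Real.sinh b ^ 2 := by gcongr
    rw [damping, Real.tanh_eq_sinh_div_cosh, inv_eq_one_div (b ^ 2)]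
    have : ((Real.sinh b / Real.cosh b) ^ 2)⁻¹ * (1 / (4 * Real.cosh b ^ 2)) =
        1 / (4 * Real.sinh b ^ 2) := by field_simp
    rw [this]
    gcongr
    nlinarith
  · gcongr
    rw [Real.tanh_eq_sinh_div_cosh, div_le_iff₀ hc]
    exact sinh_le_mul_cosh hb.le

end Field

section Recursion

/-- Half the log-likelihood ratio of a pair of weights. -/
def halfLogRatio (p : ℝ × ℝ) : ℝ := (Real.log p.1 - Real.log p.2) / 2

lemma pullback_pos (b : ℝ) (k : ℕ) {p : ℝ × ℝ} (h1 : 0 < p.1) (h2 : 0 < p.2) :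
    0 < (pullback b k p).1 ∧ 0 < (pullback b k p).2 := by
  unfold pullback
  constructor <;> positivity

lemma halfLogRatio_pullback (b : ℝ) (k : ℕ) {p : ℝ × ℝ} (h1 : 0 < p.1) (h2 : 0 < p.2) :
    halfLogRatio (pullback b k p) = k * transmit b (halfLogRatio p) := by
  obtain ⟨p1, p2⟩ := p
  obtain ⟨u, rfl⟩ : ∃ u, Real.exp u = p1 := ⟨_, Real.exp_log h1⟩
  obtain ⟨v, rfl⟩ : ∃ v, Real.exp v = p2 := ⟨_, Real.exp_log h2⟩
  have e : ∀ a : ℝ, Real.exp a * Real.exp u + Real.exp (-a) * Real.exp v =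
      2 * Real.exp ((u + v) / 2) * Real.cosh (a + (u - v) / 2) := by
    intro a
    rw [Real.cosh_eq, mul_comm 2, mul_assoc, mul_div_cancel₀ _ two_ne_zero, mul_add,
      ← Real.exp_add, ← Real.exp_add, ← Real.exp_add, ← Real.exp_add]
    ring_nf
  have e1 := e b
  have e2 := e (-b)
  rw [neg_neg] at e2
  have hc : Real.cosh (-b + (u - v) / 2) = Real.cosh (b - (u - v) / 2) := by
    rw [← Real.cosh_neg]
    ring_nf
  simp only [halfLogRatio, pullback, transmit, Real.log_pow, Real.log_exp]
  rw [e1, e2, hc, Real.log_mul (by positivity) (Real.cosh_pos _).ne',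
    Real.log_mul (by positivity) (Real.cosh_pos _).ne']
  ring

/-- The inverse square of `θ ^ k` times the size of level `k`. -/
def invSqSize (θ : ℝ) (d : ℕ → ℕ) (k : ℕ) : ℝ := ∏ j ∈ Finset.range k, ((d j * θ : ℝ) ^ 2)⁻¹

lemma halfLogRatio_rootWeight {b : ℝ} (hb : 0 < b) {d : ℕ → ℕ} (hd : ∀ n, 0 < d n) (N : ℕ)
    {p : ℝ × ℝ} (h1 : 0 < p.1) (h2 : 0 < p.2) (h : 0 < halfLogRatio p) :
    0 < (rootWeight b d N p).1 ∧ 0 < (rootWeight b d N p).2 ∧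
    0 < halfLogRatio (rootWeight b d N p) ∧
    invSqSize (Real.tanh b) d N * (halfLogRatio p ^ 2)⁻¹ +
      damping b * ∑ k ∈ Finset.range N, invSqSize (Real.tanh b) d (k + 1) ≤
        (halfLogRatio (rootWeight b d N p) ^ 2)⁻¹ ∧
    (halfLogRatio (rootWeight b d N p) ^ 2)⁻¹ ≤
      invSqSize (Real.tanh b) d N * (halfLogRatio p ^ 2)⁻¹ +
        ∑ k ∈ Finset.range N, invSqSize (Real.tanh b) d (k + 1) := by
  induction N generalizing p with
  | zero => simp [rootWeight, invSqSize, h1, h2, h]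
  | succ N ih =>
    have hdN : (0 : ℝ) < d N := Nat.cast_pos.2 (hd N)
    have hr := halfLogRatio_pullback b (d N) h1 h2
    obtain ⟨q1, q2⟩ := pullback_pos b (d N) h1 h2
    have ht := transmit_pos hb h
    obtain ⟨i1, i2, i3, i4, i5⟩ := ih q1 q2 (by rw [hr]; positivity)
    obtain ⟨l, u⟩ := inv_transmit_sq_bounds hb h
    have hP : 0 ≤ invSqSize (Real.tanh b) d N * ((d N : ℝ) ^ 2)⁻¹ :=
      mul_nonneg (Finset.prod_nonneg fun j _ => by positivity) (by positivity)
    have hs : invSqSize (Real.tanh b) d (N + 1) =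
        invSqSize (Real.tanh b) d N * ((d N : ℝ) ^ 2)⁻¹ * (Real.tanh b ^ 2)⁻¹ := by
      rw [invSqSize, Finset.prod_range_succ, mul_pow, mul_inv, invSqSize, mul_assoc]
    have l' := mul_le_mul_of_nonneg_left l hP
    have u' := mul_le_mul_of_nonneg_left u hP
    rw [hr, mul_pow, mul_inv] at i4 i5
    rw [Finset.sum_range_succ]
    refine ⟨i1, i2, i3, ?_, ?_⟩
    · rw [rootWeight]
      refine le_trans ?_ i4
      rw [hs]
      linarith
    · rw [rootWeight]
      refine i5.trans ?_
      rw [hs]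
      linarith

lemma exists_plusProb_eq {c : Vtx → ℕ} {J β : ℝ} (hb : 0 < β * J) {d : ℕ → ℕ}
    (hd : ∀ n, ∀ v ∈ lev c n, c v = d n) (hpos : ∀ n, 0 < d n) (N : ℕ) :
    ∃ y : ℝ, 0 < y ∧ plusProb c (fun _ => J) β (N + 1) = (1 + Real.exp (-2 * y))⁻¹ ∧
      damping (β * J) * ∑ k ∈ Finset.range (N + 1), invSqSize (Real.tanh (β * J)) d (k + 1) ≤
        (y ^ 2)⁻¹ ∧
      (y ^ 2)⁻¹ ≤ ∑ k ∈ Finset.range (N + 1), invSqSize (Real.tanh (β * J)) d (k + 1) := by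
  set b := β * J with hbdef
  set p := pullback b (d N) (1, 0) with hp
  have hp' : p = (Real.exp b ^ d N, Real.exp (-b) ^ d N) := by simp [hp, pullback]
  have h1 : 0 < p.1 := by rw [hp']; positivity
  have h2 : 0 < p.2 := by rw [hp']; positivity
  have hdN : (0 : ℝ) < d N := Nat.cast_pos.2 (hpos N)
  have hr : halfLogRatio p = d N * b := by
    simp only [hp', halfLogRatio, Real.log_pow, Real.log_exp]
    ring
  obtain ⟨i1, i2, i3, i4, i5⟩ :=
    halfLogRatio_rootWeight hb hpos N h1 h2 (by rw [hr]; positivity)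
  obtain ⟨l, u⟩ := inv_sq_bounds hb
  have hP : 0 ≤ invSqSize (Real.tanh b) d N * ((d N : ℝ) ^ 2)⁻¹ :=
    mul_nonneg (Finset.prod_nonneg fun j _ => by positivity) (by positivity)
  have hs : invSqSize (Real.tanh b) d (N + 1) =
      invSqSize (Real.tanh b) d N * ((d N : ℝ) ^ 2)⁻¹ * (Real.tanh b ^ 2)⁻¹ := by
    rw [invSqSize, Finset.prod_range_succ, mul_pow, mul_inv, invSqSize, mul_assoc]
  have l' := mul_le_mul_of_nonneg_left l hP
  have u' := mul_le_mul_of_nonneg_left u hP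
  rw [hr, mul_pow, mul_inv] at i4 i5
  rw [Finset.sum_range_succ, hs]
  refine ⟨_, i3, ?_, by linarith, by linarith⟩
  rw [plusProb_eq J β hd, rootWeight, ← hbdef, ← hp]
  have he : Real.exp (-2 * halfLogRatio (rootWeight b d N p)) =
      (rootWeight b d N p).2 / (rootWeight b d N p).1 := by
    rw [halfLogRatio, ← Real.exp_log i1, ← Real.exp_log i2, ← Real.exp_sub]
    simp only [Real.log_exp]
    ring_nf
  rw [he]
  field_simp

lemma invSqSize_eq {c : Vtx → ℕ} (θ : ℝ) {d : ℕ → ℕ} (hd : ∀ n, ∀ v ∈ lev c n, c v = d n)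
    (k : ℕ) : invSqSize θ d k = (((lev c k).card * θ ^ k : ℝ) ^ 2)⁻¹ := by
  induction k with
  | zero => simp [invSqSize, lev]
  | succ k ih =>
    rw [invSqSize, Finset.prod_range_succ, ← invSqSize, ih, card_lev_succ (hd k), ← mul_inv]
    push_cast
    ring

end Recursion

theorem stmt4 (c : Vtx → ℕ)
    (hsph : ∀ v w : Vtx, IsVtx c v → IsVtx c w → v.length = w.length → c v = c w)
    (J β : ℝ) (hJ : 0 < J) (hβ : 0 < β)
    (α cc CC : ℝ) (hcc : 0 < cc) (hcC : cc ≤ CC)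
    (hcard : ∀ n : ℕ, 1 ≤ n →
      cc * (Real.tanh (β * J))⁻¹ ^ n * (n : ℝ) ^ α ≤ ((lev c n).card : ℝ) ∧
      ((lev c n).card : ℝ) ≤ CC * (Real.tanh (β * J))⁻¹ ^ n * (n : ℝ) ^ α) :
    Filter.Tendsto (fun N : ℕ => plusProb c (fun _ => J) β N) Filter.atTop
        (nhds (1 / 2)) ↔ α ≤ 1 / 2 := by
  set b := β * J with hbdef
  have hb : 0 < b := mul_pos hβ hJ
  have hθ : 0 < Real.tanh b := tanh_pos_of_pos hb
  have hcardpos : ∀ n, 0 < (lev c n).card := by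
    intro n
    rcases Nat.eq_zero_or_pos n with rfl | hn
    · simp [lev]
    · have hn' : (0 : ℝ) < n := Nat.cast_pos.2 hn
      exact_mod_cast (show (0 : ℝ) < cc * (Real.tanh b)⁻¹ ^ n * (n : ℝ) ^ α by
        positivity).trans_le (hcard n hn).1
  obtain ⟨d, hd⟩ : ∃ d : ℕ → ℕ, ∀ n, ∀ v ∈ lev c n, c v = d n := by
    choose u hu using fun n => Finset.card_pos.1 (hcardpos n)
    refine ⟨fun n => c (u n), fun n v hv => ?_⟩
    obtain ⟨h1, h2⟩ := isVtx_and_length_of_mem_lev hv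
    obtain ⟨h3, h4⟩ := isVtx_and_length_of_mem_lev (hu n)
    exact hsph v (u n) h1 h3 (h2.trans h4.symm)
  have hdpos : ∀ n, 0 < d n := fun n => by
    have := hcardpos (n + 1)
    rw [card_lev_succ (hd n)] at this
    exact Nat.pos_of_mul_pos_left this
  set P := invSqSize (Real.tanh b) d with hP
  have hCC : 0 < CC := hcc.trans_le hcC
  have hbounds : ∀ k : ℕ, (CC ^ 2)⁻¹ * ((k + 1 : ℕ) : ℝ) ^ (-(2 * α)) ≤ P (k + 1) ∧
      P (k + 1) ≤ (cc ^ 2)⁻¹ * ((k + 1 : ℕ) : ℝ) ^ (-(2 * α)) := by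
    intro k
    obtain ⟨l, u⟩ := hcard (k + 1) (by omega)
    have hk : (0 : ℝ) < ((k + 1 : ℕ) : ℝ) := by positivity
    have hc := hcardpos (k + 1)
    have hc' : (0 : ℝ) < (lev c (k + 1)).card := Nat.cast_pos.2 hc
    have e : ∀ A : ℝ, (A ^ 2)⁻¹ * ((k + 1 : ℕ) : ℝ) ^ (-(2 * α)) =
        ((A * ((k + 1 : ℕ) : ℝ) ^ α) ^ 2)⁻¹ := by
      intro A
      rw [Real.rpow_neg hk.le, mul_comm 2 α, Real.rpow_mul hk.le, Real.rpow_two, mul_pow, mul_inv]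
    have hcancel : ∀ A : ℝ, A * (Real.tanh b)⁻¹ ^ (k + 1) * ((k + 1 : ℕ) : ℝ) ^ α *
        Real.tanh b ^ (k + 1) = A * ((k + 1 : ℕ) : ℝ) ^ α := by
      intro A
      rw [inv_pow]
      field_simp
    have l' := mul_le_mul_of_nonneg_right l (pow_pos hθ (k + 1)).le
    have u' := mul_le_mul_of_nonneg_right u (pow_pos hθ (k + 1)).le
    rw [hcancel] at l' u'
    rw [e, e, hP, invSqSize_eq _ hd]
    constructor <;> gcongr
  have hPnonneg : ∀ k, 0 ≤ P (k + 1) := fun k => le_trans (by positivity) (hbounds k).1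
  have hsummable : Summable (fun k => P (k + 1)) ↔ 1 / 2 < α := by
    have h1 : Summable (fun k : ℕ => ((k + 1 : ℕ) : ℝ) ^ (-(2 * α))) ↔ 1 / 2 < α := by
      rw [summable_nat_add_iff (f := fun k : ℕ => (k : ℝ) ^ (-(2 * α))) 1, Real.summable_nat_rpow]
      constructor <;> intro h <;> linarith
    rw [← h1]
    constructor
    · intro h
      refine (summable_mul_left_iff (inv_ne_zero (pow_ne_zero 2 hCC.ne'))).1 ?_
      exact Summable.of_nonneg_of_le (fun k => by positivity) (fun k => (hbounds k).1) h
    · intro h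
      exact Summable.of_nonneg_of_le hPnonneg (fun k => (hbounds k).2) (h.mul_left _)
  choose y hy0 hyeq hyl hyu using exists_plusProb_eq hb hd hdpos
  rw [← Filter.tendsto_add_atTop_iff_nat 1]
  simp only [hyeq]
  constructor
  · intro hlim
    by_contra! hα
    have hS := hsummable.2 hα
    set M := ∑' k, P (k + 1) with hM
    have hyM : ∀ N, (y N ^ 2)⁻¹ ≤ M := fun N =>
      (hyu N).trans (hS.sum_le_tsum _ fun k _ => hPnonneg k)
    have hMpos : 0 < M := lt_of_lt_of_le (by have := hy0 0; positivity) (hyM 0)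
    have hylow : ∀ N, √(M⁻¹) ≤ y N := by
      intro N
      refine Real.sqrt_le_iff.2 ⟨(hy0 N).le, ?_⟩
      exact inv_le_of_inv_le₀ (by have := hy0 N; positivity) (hyM N)
    have hδ : 0 < √(M⁻¹) := Real.sqrt_pos.2 (inv_pos.2 hMpos)
    have hge : (1 + Real.exp (-2 * √(M⁻¹)))⁻¹ ≤ 1 / 2 := by
      refine ge_of_tendsto' hlim fun N => ?_
      have := hylow N
      have h : Real.exp (-2 * y N) ≤ Real.exp (-2 * √(M⁻¹)) :=
        Real.exp_le_exp.2 (by linarith)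
      gcongr
    have hlt : Real.exp (-2 * √(M⁻¹)) < 1 := by
      rw [← Real.exp_zero]
      exact Real.exp_lt_exp.2 (by linarith)
    rw [one_div] at hge
    have := (inv_le_inv₀ (by positivity) (by norm_num)).1 hge
    linarith
  · intro hα
    have hdiv : Filter.Tendsto (fun N => ∑ k ∈ Finset.range N, P (k + 1)) Filter.atTop
        Filter.atTop :=
      (not_summable_iff_tendsto_nat_atTop_of_nonneg hPnonneg).1
        (fun h => not_lt.2 hα (hsummable.1 h))
    have hinv : Filter.Tendsto (fun N => (y N ^ 2)⁻¹) Filter.atTop Filter.atTop :=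
      Filter.tendsto_atTop_mono hyl
        (((Filter.tendsto_add_atTop_iff_nat 1).2 hdiv).const_mul_atTop (damping_pos b))
    have hsq : Filter.Tendsto (fun N => y N ^ 2) Filter.atTop (nhds 0) := by
      refine hinv.inv_tendsto_atTop.congr fun N => ?_
      simp
    have hy : Filter.Tendsto y Filter.atTop (nhds 0) := by
      have := hsq.sqrt
      simpa [Real.sqrt_sq (hy0 _).le] using this
    have h := ((((hy.const_mul (-2)).rexp).const_add 1).inv₀ (by positivity))
    have e : (1 + Real.exp (-2 * 0))⁻¹ = (1 / 2 : ℝ) := by norm_num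
    rwa [e] at h
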